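/- For every integer i ≥ 2 and every finite simple graph T with at least one vertex, t(C_2, T)^{2i−2} · t(C_{2i+1}, T) ≥ t(C_3, T)^{2i−1}. -/

import Mathlib

open SimpleGraph

/-- The homomorphism density `t(G,T)`. -/
noncomputable def homDensity {α β : Type*} [Fintype α] [Fintype β]
    (G : SimpleGraph α) (T : SimpleGraph β) : ℝ :=
  (Nat.card (G →g T) : ℝ) / (Fintype.card β : ℝ) ^ (Fintype.card α)

lemma log_jensen {ι : Type*} [Fintype ι] (a g : ι → ℝ) (ha : ∀ i, 0 ≤ a i)
    (hg : ∀ i, 0 < a i → 0 < g i) :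
    ∑ i, a i * Real.log (g i) + (∑ i, a i) * Real.log (∑ i, a i)
      ≤ (∑ i, a i) * Real.log (∑ i, a i * g i) := by
  have hs0 : 0 ≤ ∑ i, a i := Finset.sum_nonneg fun i _ => ha i
  rcases hs0.eq_or_lt with hs | hs
  · have h0 : ∀ i, a i = 0 := fun i =>
      (Finset.sum_eq_zero_iff_of_nonneg fun i _ => ha i).1 hs.symm i (Finset.mem_univ i)
    simp [h0]
  · obtain ⟨j, -, hj⟩ : ∃ j ∈ Finset.univ, 0 < a j := by
      by_contra! h
      exact absurd (Finset.sum_nonpos h) (not_le.2 hs)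
    have hag : ∀ i, 0 ≤ a i * g i := fun i => by
      rcases (ha i).eq_or_lt with h | h
      · simp [← h]
      · exact (mul_pos h (hg i h)).le
    have hG : 0 < ∑ i, a i * g i :=
      Finset.sum_pos' (fun i _ => hag i) ⟨j, Finset.mem_univ j, mul_pos hj (hg j hj)⟩
    set s := ∑ i, a i with hsdef
    set G := ∑ i, a i * g i with hGdef
    have key : ∀ i, a i * Real.log (g i) ≤
        a i * (Real.log G - Real.log s) + (a i * g i) * (s / G) - a i := fun i => by
      rcases (ha i).eq_or_lt with h | h
      · simp [← h]
      · have hgi := hg i h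
        have h1 := Real.log_le_sub_one_of_pos (x := g i * (s / G)) (by positivity)
        rw [Real.log_mul hgi.ne' (by positivity), Real.log_div hs.ne' hG.ne'] at h1
        nlinarith
    have h2 := Finset.sum_le_sum fun i (_ : i ∈ Finset.univ) => key i
    rw [Finset.sum_sub_distrib, Finset.sum_add_distrib, ← Finset.sum_mul, ← Finset.sum_mul,
      ← hsdef, ← hGdef, mul_div_cancel₀ _ hG.ne'] at h2
    linarith

lemma blakley_roy {D : Type*} [Fintype D] [DecidableEq D] (A : Matrix D D ℝ)
    (hA : ∀ x y, 0 ≤ A x y) (hs : ∀ x y, A x y = A y x) (k : ℕ) :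
    (∑ x, ∑ y, A x y) ^ (k + 1) ≤ (Fintype.card D : ℝ) ^ k * ∑ x, ∑ y, (A ^ (k + 1)) x y := by
  set d : D → ℝ := fun x => ∑ y, A x y with hd
  set g : ℕ → D → ℝ := fun k x => ∑ y, (A ^ k) x y with hgd
  have hd0 : ∀ x, 0 ≤ d x := fun x => Finset.sum_nonneg fun y _ => hA x y
  have gs : ∀ k x, g (k + 1) x = ∑ y, A x y * g k y := fun k x => by
    simp only [hgd, pow_succ', Matrix.mul_apply, Finset.mul_sum]
    exact Finset.sum_comm
  have dpos : ∀ x y, 0 < A x y → 0 < d y := fun x y h =>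
    Finset.sum_pos' (fun z _ => hA y z) ⟨x, Finset.mem_univ x, by rw [hs]; exact h⟩
  have g0 : ∀ x, g 0 x = 1 := fun x => by simp [hgd, Matrix.one_apply]
  have gnn : ∀ k x, 0 ≤ g k x := by
    intro k
    induction k with
    | zero => intro x; simp [g0]
    | succ k ih =>
      intro x
      rw [gs]
      exact Finset.sum_nonneg fun y _ => mul_nonneg (hA x y) (ih y)
  have gpos : ∀ k x, 0 < d x → 0 < g k x := by
    intro k
    induction k with
    | zero => intro x _; simp [g0]
    | succ k ih =>
      intro x hx
      rw [gs]
      obtain ⟨y, -, hy⟩ : ∃ y ∈ Finset.univ, 0 < A x y := by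
        by_contra! h
        exact absurd (Finset.sum_nonpos h) (not_le.2 hx)
      exact Finset.sum_pos' (fun z _ => mul_nonneg (hA x z) (gnn k z))
        ⟨y, Finset.mem_univ y, mul_pos hy (ih y (dpos x y hy))⟩
  have step : ∀ k : ℕ, (k : ℝ) * ∑ x, d x * Real.log (d x) ≤ ∑ x, d x * Real.log (g k x) := by
    intro k
    induction k with
    | zero => simp [g0]
    | succ k ih =>
      have h1 := Finset.sum_le_sum fun x (_ : x ∈ Finset.univ) =>
        log_jensen (A x) (g k) (hA x) (fun y hy => gpos k y (dpos x y hy))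
      simp only [← gs] at h1
      rw [Finset.sum_add_distrib, Finset.sum_comm] at h1
      have h2 : ∑ y, ∑ x, A x y * Real.log (g k y) = ∑ y, d y * Real.log (g k y) := by
        refine Finset.sum_congr rfl fun y _ => ?_
        rw [← Finset.sum_mul]
        congr 1
        exact Finset.sum_congr rfl fun x _ => hs x y
      rw [h2] at h1
      change _ + ∑ x, d x * Real.log (d x) ≤ ∑ x, d x * Real.log (g (k+1) x) at h1
      push_cast
      linarith
  have hw : ∑ x, g (k + 1) x = ∑ x, d x * g k x := by
    simp only [gs]
    rw [Finset.sum_comm]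
    refine Finset.sum_congr rfl fun y _ => ?_
    rw [← Finset.sum_mul]
    congr 1
    exact Finset.sum_congr rfl fun x _ => hs x y
  change (∑ x, d x) ^ (k + 1) ≤ _ * ∑ x, g (k + 1) x
  have hS0 : 0 ≤ ∑ x, d x := Finset.sum_nonneg fun i _ => hd0 i
  rcases hS0.eq_or_lt with hS | hS
  · rw [← hS, zero_pow (Nat.succ_ne_zero k)]
    exact mul_nonneg (by positivity) (Finset.sum_nonneg fun x _ => gnn _ x)
  obtain ⟨j, -, hj⟩ : ∃ j ∈ Finset.univ, 0 < d j := by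
    by_contra! h
    exact absurd (Finset.sum_nonpos h) (not_le.2 hS)
  have : Nonempty D := ⟨j⟩
  have hn : (0 : ℝ) < Fintype.card D := by exact_mod_cast Fintype.card_pos
  have hW : 0 < ∑ x, g (k + 1) x :=
    Finset.sum_pos' (fun x _ => gnn _ x) ⟨j, Finset.mem_univ j, gpos _ j hj⟩
  have j1 := log_jensen d (g k) hd0 (gpos k)
  rw [← hw] at j1
  have j2 := log_jensen d (fun x => (d x)⁻¹) hd0 (fun x hx => inv_pos.2 hx)
  have hle : ∑ x, d x * (d x)⁻¹ ≤ Fintype.card D := by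
    calc ∑ x, d x * (d x)⁻¹ ≤ ∑ x : D, (1 : ℝ) := Finset.sum_le_sum fun x _ => mul_inv_le_one
      _ = _ := by simp
  have hpos : 0 < ∑ x, d x * (d x)⁻¹ :=
    Finset.sum_pos' (fun x _ => mul_nonneg (hd0 x) (inv_nonneg.2 (hd0 x)))
      ⟨j, Finset.mem_univ j, mul_pos hj (inv_pos.2 hj)⟩
  have hlog := mul_le_mul_of_nonneg_left (Real.log_le_log hpos hle) hS.le
  simp only [Real.log_inv, mul_neg, Finset.sum_neg_distrib] at j2
  have hk := step k
  set S := ∑ x, d x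
  set E := ∑ x, d x * Real.log (d x)
  have hE : S * Real.log S - S * Real.log (Fintype.card D) ≤ E := by linarith
  have hE2 := mul_le_mul_of_nonneg_left hE (Nat.cast_nonneg (α := ℝ) k)
  have fin : S * ((k + 1) * Real.log S) ≤
      S * (k * Real.log (Fintype.card D) + Real.log (∑ x, g (k + 1) x)) := by
    linarith
  have fin2 := le_of_mul_le_mul_left fin hS
  rw [← Real.log_le_log_iff (by positivity) (by positivity),
    Real.log_mul (by positivity) (by positivity), Real.log_pow, Real.log_pow]
  push_cast
  exact fin2

/-- Ordered adjacent pairs. -/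
abbrev AdjPair {β : Type*} (T : SimpleGraph β) : Type _ := {p : β × β // T.Adj p.1 p.2}

/-- The graph on ordered adjacent pairs, `(v,x) ~ (v,y)` iff `x ~ y`. -/
def linkG {β : Type*} (T : SimpleGraph β) : SimpleGraph (AdjPair T) where
  Adj p q := p.1.1 = q.1.1 ∧ T.Adj p.1.2 q.1.2
  symm := ⟨fun _ _ h => ⟨h.1.symm, h.2.symm⟩⟩
  loopless := ⟨fun _ h => T.loopless.irrefl _ h.2⟩

lemma walk_fst {β : Type*} (T : SimpleGraph β) {u w} (p : (linkG T).Walk u w) (n : ℕ) :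
    (p.getVert n).1.1 = u.1.1 := by
  induction p generalizing n with
  | nil => simp
  | cons h p ih =>
    cases n with
    | zero => simp
    | succ n => simp only [Walk.getVert_cons_succ]; rw [ih, h.1]

/-- Closed up walk. -/
def walkHom {β : Type*} (T : SimpleGraph β) (k : ℕ) {u w} (p : (linkG T).Walk u w)
    (hp : p.length = k + 1) : cycleGraph (k + 3) →g T where
  toFun j := if j.val ≤ k + 1 then (p.getVert j.val).1.2 else u.1.1
  map_rel' := by
    have key : ∀ a b : Fin (k + 3), b - a = 1 →
        T.Adj (if a.val ≤ k + 1 then (p.getVert a.val).1.2 else u.1.1)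
          (if b.val ≤ k + 1 then (p.getVert b.val).1.2 else u.1.1) := by
      intro a b hab
      have hb : b = a + 1 := by rw [← hab]; abel
      have ha := a.isLt
      have hbv : b.val = if a.val = k + 2 then 0 else a.val + 1 := by
        rw [hb, Fin.val_add_one]
        simp [Fin.ext_iff]
      have e : ∀ n, T.Adj u.1.1 (p.getVert n).1.2 := fun n => by
        have := (p.getVert n).2
        rwa [walk_fst] at this
      by_cases h2 : a.val = k + 2
      · rw [if_pos h2] at hbv
        rw [if_neg (by omega), if_pos (by omega)]
        exact e _
      · rw [if_neg h2] at hbv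
        rw [if_pos (by omega)]
        split_ifs with h3
        · rw [hbv]
          exact (p.adj_getVert_succ (by omega)).2
        · exact (e _).symm
    intro a b hab
    rw [cycleGraph_adj] at hab
    rcases hab with h | h
    · exact (key b a h).symm
    · exact key a b h

lemma walkHom_inj {β : Type*} (T : SimpleGraph β) (k : ℕ) {u w u' w'} (p : (linkG T).Walk u w)
    (hp : p.length = k + 1) (p' : (linkG T).Walk u' w')
    (hp' : p'.length = k + 1) (h : walkHom T k p hp = walkHom T k p' hp') (n : ℕ) :
    p.getVert n = p'.getVert n := by
  have hf : ∀ j : Fin (k + 3), (if j.val ≤ k + 1 then (p.getVert j.val).1.2 else u.1.1) =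
    (if j.val ≤ k + 1 then (p'.getVert j.val).1.2 else u'.1.1) := fun j => DFunLike.congr_fun h j
  have hv : u.1.1 = u'.1.1 := by
    simpa using hf ⟨k + 2, by omega⟩
  have main : ∀ n, n ≤ k + 1 → p.getVert n = p'.getVert n := fun n hn => by
    apply Subtype.ext
    apply Prod.ext
    · rw [walk_fst, walk_fst, hv]
    · have := hf ⟨n, by omega⟩
      simpa [hn] using this
  by_cases hn : n ≤ k + 1
  · exact main n hn
  · have h1 := main (k + 1) le_rfl
    rw [p.getVert_of_length_le (by omega), p'.getVert_of_length_le (by omega)]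
    rwa [p.getVert_of_length_le (by omega), p'.getVert_of_length_le (by omega)] at h1

open Classical in
lemma hom_ineq {β : Type*} [Fintype β] (T : SimpleGraph β) (k : ℕ) :
    (Nat.card (cycleGraph 3 →g T) : ℝ) ^ (k + 1) ≤
      (Nat.card (cycleGraph 2 →g T) : ℝ) ^ k * Nat.card (cycleGraph (k + 3) →g T) := by
  have br := blakley_roy ((linkG T).adjMatrix ℝ)
    (fun x y => by rw [adjMatrix_apply]; split_ifs <;> simp)
    (fun x y => by simp [adjMatrix_apply, (linkG T).adj_comm]) k
  have fin : ∀ n, Finite (cycleGraph n →g T) := fun n =>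
    Finite.of_injective (fun f : cycleGraph n →g T => (f : Fin n → β)) DFunLike.coe_injective
  have h3 : (Nat.card (cycleGraph 3 →g T) : ℝ) ≤ ∑ x, ∑ y, (linkG T).adjMatrix ℝ x y := by
    have e : ∑ x, ∑ y, (linkG T).adjMatrix ℝ x y =
        (Nat.card {q : AdjPair T × AdjPair T // (linkG T).Adj q.1 q.2} : ℝ) := by
      refine (Fintype.sum_prod_type' (fun x y => (linkG T).adjMatrix ℝ x y)).symm.trans ?_
      rw [Nat.card_eq_fintype_card, Fintype.card_subtype]
      simp [adjMatrix_apply]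
    rw [e]
    norm_cast
    have ad : ∀ a b : Fin 3, a ≠ b → (cycleGraph 3).Adj a b := by decide
    refine Nat.card_le_card_of_injective (fun f : cycleGraph 3 →g T =>
      ⟨(⟨(f 0, f 1), f.map_adj (ad 0 1 (by decide))⟩, ⟨(f 0, f 2), f.map_adj (ad 0 2 (by decide))⟩),
        ⟨rfl, f.map_adj (ad 1 2 (by decide))⟩⟩) ?_
    intro f f' h
    have h1 := congrArg (fun q => q.1.1.1) h
    have h2 := congrArg (fun q => q.1.2.1) h
    simp only [Prod.mk.injEq] at h1 h2
    ext j
    fin_cases j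
    · exact h1.1
    · exact h1.2
    · exact h2.2
  have h2 : (Fintype.card (AdjPair T) : ℝ) ≤ Nat.card (cycleGraph 2 →g T) := by
    rw [← Nat.card_eq_fintype_card]
    norm_cast
    refine Nat.card_le_card_of_injective (fun p : AdjPair T => (⟨![p.1.1, p.1.2], ?_⟩ : cycleGraph 2 →g T)) ?_
    · intro a b hab
      fin_cases a <;> fin_cases b
      · exact absurd hab ((cycleGraph 2).loopless.irrefl _)
      · exact p.2
      · exact p.2.symm
      · exact absurd hab ((cycleGraph 2).loopless.irrefl _)
    · intro p q h
      have h' := fun j => DFunLike.congr_fun h j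
      exact Subtype.ext (Prod.ext (h' 0) (h' 1))
  have hk : ∑ x, ∑ y, ((linkG T).adjMatrix ℝ ^ (k + 1)) x y ≤
      Nat.card (cycleGraph (k + 3) →g T) := by
    have e : ∑ x, ∑ y, ((linkG T).adjMatrix ℝ ^ (k + 1)) x y =
        (Nat.card (Σ q : AdjPair T × AdjPair T, {p : (linkG T).Walk q.1 q.2 | p.length = k + 1}) : ℝ) := by
      refine (Fintype.sum_prod_type' (fun x y => ((linkG T).adjMatrix ℝ ^ (k + 1)) x y)).symm.trans ?_
      rw [Nat.card_eq_fintype_card, Fintype.card_sigma]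
      push_cast
      refine Finset.sum_congr rfl fun q _ => ?_
      rw [adjMatrix_pow_apply_eq_card_walk]
    rw [e]
    norm_cast
    refine Nat.card_le_card_of_injective
      (fun s : (Σ q : AdjPair T × AdjPair T, {p : (linkG T).Walk q.1 q.2 | p.length = k + 1}) =>
        walkHom T k s.2.1 s.2.2) ?_
    rintro ⟨⟨u, w⟩, p, hp⟩ ⟨⟨u', w'⟩, p', hp'⟩ h
    have hv := walkHom_inj T k p hp p' hp' h
    have hu : u = u' := by simpa using hv 0
    have hw : w = w' := by
      have := hv (k + 1)
      simp only [Set.mem_ofPred_eq] at hp hp'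
      rwa [p.getVert_of_length_le (by simpa using hp.le),
        p'.getVert_of_length_le (by simpa using hp'.le)] at this
    subst hu hw
    have : p = p' := Walk.ext_getVert hv
    subst this
    rfl
  calc _ ≤ (∑ x, ∑ y, (linkG T).adjMatrix ℝ x y) ^ (k + 1) := by gcongr
    _ ≤ _ := br
    _ ≤ _ := by
      have : 0 ≤ ∑ x, ∑ y, ((linkG T).adjMatrix ℝ ^ (k + 1)) x y :=
        Finset.sum_nonneg fun x _ => Finset.sum_nonneg fun y _ => by
          rw [adjMatrix_pow_apply_eq_card_walk]; positivity
      gcongr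

theorem stmt_19 (i : ℕ) (hi : 2 ≤ i)
    {β : Type*} [Fintype β] [Nonempty β] (T : SimpleGraph β) :
    homDensity (cycleGraph 3) T ^ (2*i - 1) ≤
      homDensity (cycleGraph 2) T ^ (2*i - 2) * homDensity (cycleGraph (2*i+1)) T := by
  obtain ⟨j, rfl⟩ := Nat.exists_eq_add_of_le hi
  have h := hom_ineq T (2 * j + 2)
  have e1 : 2 * (2 + j) - 1 = 2 * j + 2 + 1 := by omega
  have e2 : 2 * (2 + j) - 2 = 2 * j + 2 := by omega
  have e3 : 2 * (2 + j) + 1 = 2 * j + 2 + 3 := by omega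
  rw [e1, e2, e3]
  have hn : (0 : ℝ) < Fintype.card β := by exact_mod_cast Fintype.card_pos
  simp only [homDensity, Fintype.card_fin, div_pow]
  rw [div_mul_div_comm, ← pow_mul, ← pow_mul, ← pow_add]
  have e4 : 2 * (2 * j + 2) + (2 * j + 2 + 3) = 3 * (2 * j + 2 + 1) := by ring
  rw [e4]
  gcongr
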